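/- (Property 2.) Let b^l and b^r be structuring functions with nonempty finite supports contained in Db and values < M on their supports. Define E(b^l, f) = ε_{b^l}(f) ⊟ ε_b(f), E(b^r, f) = ε_{b^r}(f) ⊟ ε_b(f) (pointwise LIP-differences), and the bump detector E(b, f)(x) = max( E(b^l, f)(x), E(b^r, f)(x) ). Then for every constant c < M: E(b^l, f ⊞ c) = E(b^l, f), E(b^r, f ⊞ c) = E(b^r, f), and E(b, f ⊞ c) = E(b, f), where (f ⊞ c)(y) = f(y) ⊞ c pointwise. -/

import Mathlib

/-- LIP-addition: a ⊞ b = a + b - a·b/M. -/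
noncomputable def lipAdd (M a b : ℝ) : ℝ := a + b - a * b / M

/-- LIP-difference (defined when b < M): a ⊟ b = M·(a - b)/(M - b). -/
noncomputable def lipSub (M a b : ℝ) : ℝ := M * (a - b) / (M - b)

/-- LIP-erosion of f by a structuring function a with support Da:
ε_a(f)(x) = min_{h ∈ Da} ( f(x+h) ⊟ a(h) ). -/
noncomputable def lipErosion (M : ℝ) {G : Type*} [AddCommGroup G]
    (Da : Finset G) (hne : Da.Nonempty) (a f : G → ℝ) (x : G) : ℝ :=
  Da.inf' hne fun h => lipSub M (f (x + h)) (a h)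

/-- LIP-dilation of f by a structuring function a with support Da:
δ_a(f)(x) = max_{h ∈ Da} ( f(x−h) ⊞ a(h) ). -/
noncomputable def lipDilation (M : ℝ) {G : Type*} [AddCommGroup G]
    (Da : Finset G) (hne : Da.Nonempty) (a f : G → ℝ) (x : G) : ℝ :=
  Da.sup' hne fun h => lipAdd M (f (x - h)) (a h)

theorem lipAdd_mono_left {M c : ℝ} (hM : 0 < M) (hc : c < M) :
    Monotone fun a => lipAdd M a c := by
  intro a a' h
  have hk : 0 ≤ 1 - c / M := sub_nonneg.2 ((div_le_one hM).2 hc.le)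
  have key := mul_le_mul_of_nonneg_right h hk
  simp only [lipAdd, mul_div_assoc]
  linarith

theorem lipSub_lipAdd_left {M a b c : ℝ} (hM : M ≠ 0) (hb : b < M) :
    lipSub M (lipAdd M a c) b = lipAdd M (lipSub M a b) c := by
  have hMb : M - b ≠ 0 := (sub_pos.2 hb).ne'
  unfold lipSub lipAdd
  field_simp
  ring

theorem lipSub_lipAdd_lipAdd {M c : ℝ} (hM : 0 < M) (hc : c < M) (a b : ℝ) :
    lipSub M (lipAdd M a c) (lipAdd M b c) = lipSub M a b := by
  have hk : 1 - c / M ≠ 0 := (sub_pos.2 ((div_lt_one hM).2 hc)).ne'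
  have hnum : M * (lipAdd M a c - lipAdd M b c) = M * (a - b) * (1 - c / M) := by
    unfold lipAdd
    ring
  have hden : M - lipAdd M b c = (M - b) * (1 - c / M) := by
    unfold lipAdd
    field_simp
    ring
  rw [lipSub, hnum, hden, mul_div_mul_right _ _ hk, lipSub]

theorem lipErosion_lipAdd_const {M c : ℝ} (hM : 0 < M) (hc : c < M)
    {G : Type*} [AddCommGroup G] (Da : Finset G) (hne : Da.Nonempty) {a : G → ℝ}
    (ha : ∀ h ∈ Da, a h < M) (f : G → ℝ) (x : G) :
    lipErosion M Da hne a (fun y => lipAdd M (f y) c) x =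
      lipAdd M (lipErosion M Da hne a f x) c := by
  unfold lipErosion
  rw [Finset.apply_inf'_eq_inf'_comp hne (fun t => lipAdd M t c)
    fun _ _ => (lipAdd_mono_left hM hc).map_min]
  exact Finset.inf'_congr hne rfl fun h hh => lipSub_lipAdd_left hM.ne' (ha h hh)

/-- Property 2: with E(b^l, f) = ε_{b^l}(f) ⊟ ε_b(f),
E(b^r, f) = ε_{b^r}(f) ⊟ ε_b(f) and the bump detector
E(b, f)(x) = max( E(b^l, f)(x), E(b^r, f)(x) ), all three detectors are
insensitive to the LIP-addition of any constant c < M to the image f. -/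
theorem detectors_lipAdd_const_invariant (M : ℝ) (hM : 0 < M)
    {G : Type*} [AddCommGroup G]
    (Db : Finset G) (hne : Db.Nonempty) (b : G → ℝ) (hb : ∀ h ∈ Db, b h < M)
    (Dbl : Finset G) (hnel : Dbl.Nonempty) (hsubl : Dbl ⊆ Db)
    (bl : G → ℝ) (hbl : ∀ h ∈ Dbl, bl h < M)
    (Dbr : Finset G) (hner : Dbr.Nonempty) (hsubr : Dbr ⊆ Db)
    (br : G → ℝ) (hbr : ∀ h ∈ Dbr, br h < M)
    (f : G → ℝ) (hf : ∀ x, f x < M) (c : ℝ) (hc : c < M) :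
    let El : (G → ℝ) → G → ℝ := fun g x =>
      lipSub M (lipErosion M Dbl hnel bl g x) (lipErosion M Db hne b g x)
    let Er : (G → ℝ) → G → ℝ := fun g x =>
      lipSub M (lipErosion M Dbr hner br g x) (lipErosion M Db hne b g x)
    let E : (G → ℝ) → G → ℝ := fun g x => max (El g x) (Er g x)
    let fc : G → ℝ := fun y => lipAdd M (f y) c
    El fc = El f ∧ Er fc = Er f ∧ E fc = E f := by
  intro El Er E fc
  have hEl : El fc = El f := funext fun x => by
    simp only [El, fc, lipErosion_lipAdd_const hM hc Dbl hnel hbl,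
      lipErosion_lipAdd_const hM hc Db hne hb, lipSub_lipAdd_lipAdd hM hc]
  have hEr : Er fc = Er f := funext fun x => by
    simp only [Er, fc, lipErosion_lipAdd_const hM hc Dbr hner hbr,
      lipErosion_lipAdd_const hM hc Db hne hb, lipSub_lipAdd_lipAdd hM hc]
  exact ⟨hEl, hEr, by simp only [E, hEl, hEr]⟩
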